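/- Let τ ∈ ℂ with Im τ > 0, q := e^{2πiτ}. Let u, v ∈ ℂ∖(ℤ+ℤτ) and set x := e^{2πiu}, y := e^{2πiv}. Assume xy ∉ q^ℤ := {q^m : m ∈ ℤ}. Then Zwegers' μ-function satisfies μ(x,y) = i q^{−1/8} · e^{πi(u+v)} / ((q;q)_∞ θ(xy)) · Σ_{n∈ℤ} ((1 − xy q^{2n}) / ((1 − x q^n)(1 − y q^n))) x^{2n} y^{2n} q^{2n²}, the bilateral sum being absolutely convergent. -/

import Mathlib

noncomputable section

/-- `e z = exp(2πiz)`. -/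
def e (z : ℂ) : ℂ := Complex.exp (2 * (Real.pi : ℂ) * Complex.I * z)

/-- Infinite q-Pochhammer symbol `(a;q)_∞`. -/
def qpinf (a q : ℂ) : ℂ := ∏' j : ℕ, (1 - a * q ^ j)

/-- `θ(x) = (x;q)_∞ (q/x;q)_∞`. -/
def qtheta (q x : ℂ) : ℂ := qpinf x q * qpinf (q / x) q

/-- Jacobi theta `ϑ₁₁(v) = -i q^{1/8} e^{-πiv} (q;q)_∞ θ(e^{2πiv})`. -/
def theta11 (τ v : ℂ) : ℂ :=
  -Complex.I * e (τ / 8) * e (-v / 2) * qpinf (e τ) (e τ) * qtheta (e τ) (e v)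

/-- Zwegers' μ-function. -/
def zMu (τ u v : ℂ) : ℂ :=
  e (u / 2) / theta11 τ v *
    ∑' n : ℤ, (-1 : ℂ) ^ n * e ((n : ℂ) * v) * (e τ) ^ ((n * (n + 1)) / 2) /
      (1 - e u * (e τ) ^ n)


open Filter Topology

lemma summable_exp_linear_sub_sq (b : ℝ) {c : ℝ} (hc : 0 < c) :
    Summable fun n : ℤ => Real.exp (b * n - c * n ^ 2) := by
  have hτ : 0 < (((c / Real.pi : ℝ) : ℂ) * Complex.I).im := by simp; positivity
  have h := ((summable_jacobiTheta₂_term_iff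
    (((-b / (2 * Real.pi) : ℝ) : ℂ) * Complex.I) _).2 hτ).norm
  refine h.congr fun n => ?_
  rw [norm_jacobiTheta₂_term]
  congr 1
  simp only [Complex.mul_I_im, Complex.ofReal_re]
  field_simp
  ring

/-- The general term of the theta series `∑ exp(C)^k p^{k(k-1)}` with `p = exp P`. -/
def thetaTerm (P C : ℂ) (k : ℤ) : ℂ := Complex.exp (k * C + k * (k - 1) * P)

/-- The theta series `∑ exp(C)^k p^{k(k-1)}` with `p = exp P`. -/
def thetaSum (P C : ℂ) : ℂ := ∑' k : ℤ, thetaTerm P C k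

lemma norm_thetaTerm (P C : ℂ) (k : ℤ) :
    ‖thetaTerm P C k‖ = Real.exp ((C.re - P.re) * k - -P.re * k ^ 2) := by
  rw [thetaTerm, Complex.norm_exp]
  congr 1
  simp
  ring

lemma summable_norm_thetaTerm {P : ℂ} (hP : P.re < 0) (C : ℂ) :
    Summable fun k : ℤ => ‖thetaTerm P C k‖ := by
  simp_rw [norm_thetaTerm]
  exact summable_exp_linear_sub_sq _ (neg_pos.2 hP)

lemma hasSum_thetaTerm {P : ℂ} (hP : P.re < 0) (C : ℂ) :
    HasSum (thetaTerm P C) (thetaSum P C) :=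
  (summable_norm_thetaTerm hP C).of_norm.hasSum

lemma thetaTerm_succ (P C : ℂ) (k : ℤ) :
    thetaTerm P C (k + 1) = Complex.exp C * Complex.exp (2 * P) ^ k * thetaTerm P C k := by
  rw [thetaTerm, thetaTerm, ← Complex.exp_int_mul, ← Complex.exp_add, ← Complex.exp_add]
  congr 1
  push_cast
  ring

section TripleProduct

lemma summable_norm_neg_mul_pow {q : ℂ} (hq : ‖q‖ < 1) (a : ℂ) :
    Summable fun j : ℕ => ‖-(a * q ^ j)‖ := by
  simp_rw [norm_neg, norm_mul, norm_pow]
  exact (summable_geometric_of_lt_one (norm_nonneg _) hq).mul_left _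

lemma tendsto_qpinf {q : ℂ} (hq : ‖q‖ < 1) (a : ℂ) :
    Tendsto (fun N : ℕ => ∏ j ∈ Finset.range N, (1 - a * q ^ j)) atTop (𝓝 (qpinf a q)) := by
  have h := multipliable_one_add_of_summable (summable_norm_neg_mul_pow hq a)
  simpa only [← sub_eq_add_neg, qpinf] using h.hasProd.tendsto_prod_nat

lemma qpinf_ne_zero {q : ℂ} (hq : ‖q‖ < 1) {a : ℂ} (ha : ∀ j : ℕ, a * q ^ j ≠ 1) :
    qpinf a q ≠ 0 := by
  have h := tprod_one_add_ne_zero_of_summable (f := fun j : ℕ => -(a * q ^ j))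
    (fun j => by rw [← sub_eq_add_neg, sub_ne_zero]; exact (ha j).symm)
    (summable_norm_neg_mul_pow hq a)
  simpa only [← sub_eq_add_neg, qpinf] using h

lemma mul_pow_self_ne_one {q : ℂ} (hq : ‖q‖ < 1) (j : ℕ) : q * q ^ j ≠ 1 := by
  intro h
  have h1 : ‖q ^ (j + 1)‖ = 1 := by rw [pow_succ', h, norm_one]
  rw [norm_pow] at h1
  exact (pow_lt_one₀ (norm_nonneg _) hq j.succ_ne_zero).ne h1

/-- The reciprocal `1 / (q;q)_m` of a finite q-Pochhammer symbol, extended by `0` to `m < 0`. -/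
def invQFactorial (q : ℂ) (m : ℤ) : ℂ :=
  if m < 0 then 0 else (∏ j ∈ Finset.range m.toNat, (1 - q * q ^ j))⁻¹

lemma invQFactorial_sub_one {q : ℂ} (hq : ‖q‖ < 1) (m : ℤ) :
    invQFactorial q (m - 1) = (1 - q ^ m) * invQFactorial q m := by
  rcases lt_trichotomy m 0 with h | rfl | h
  · simp [invQFactorial, h, h.trans zero_lt_one]
  · simp [invQFactorial]
  · obtain ⟨n, rfl⟩ : ∃ n : ℕ, m = n + 1 := ⟨(m - 1).toNat, by omega⟩
    have h1 : ¬ ((n : ℤ) < 0) := by omega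
    have h2 : ¬ ((n : ℤ) + 1 < 0) := by omega
    have h3 : ((n : ℤ) + 1).toNat = n + 1 := by omega
    have h4 : 1 - q * q ^ n ≠ 0 := sub_ne_zero.2 (mul_pow_self_ne_one hq n).symm
    have h5 : q ^ ((n : ℤ) + 1) = q * q ^ n := by
      rw [← pow_succ']; exact_mod_cast zpow_natCast q (n + 1)
    simp only [invQFactorial, add_sub_cancel_right, h1, h2, h3, if_false, Int.toNat_natCast,
      Finset.prod_range_succ, mul_inv, h5]
    field_simp

lemma tendsto_invQFactorial {q : ℂ} (hq : ‖q‖ < 1) :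
    Tendsto (invQFactorial q) atTop (𝓝 (qpinf q q)⁻¹) := by
  have h := ((tendsto_qpinf hq q).inv₀ (qpinf_ne_zero hq (mul_pow_self_ne_one hq))).comp
    (tendsto_atTop_atTop.2 fun b => ⟨b, fun a ha => by omega⟩ : Tendsto Int.toNat atTop atTop)
  refine h.congr' ?_
  filter_upwards [eventually_ge_atTop 0] with m hm
  simp [invQFactorial, not_lt.2 hm]

lemma exists_norm_invQFactorial_le {q : ℂ} (hq : ‖q‖ < 1) :
    ∃ R, ∀ m, ‖invQFactorial q m‖ ≤ R := by
  have h := (tendsto_qpinf hq q).inv₀ (qpinf_ne_zero hq (mul_pow_self_ne_one hq))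
  obtain ⟨R, hR⟩ := (Metric.isBounded_range_of_tendsto _ h).exists_norm_le
  refine ⟨R, fun m => ?_⟩
  have h0 := (norm_nonneg _).trans (hR _ ⟨0, rfl⟩)
  unfold invQFactorial
  split_ifs
  · simpa using h0
  · exact hR _ ⟨m.toNat, rfl⟩

/-- Finite form of the Jacobi triple product. -/
lemma hasSum_finite_triple_product {q y : ℂ} (hq0 : q ≠ 0) (hq : ‖q‖ < 1) (hy : y ≠ 0)
    {t : ℤ → ℂ} (ht0 : t 0 = 1) (ht : ∀ k, t (k + 1) = -y * q ^ k * t k) (N : ℕ) :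
    HasSum (fun k : ℤ => (∏ j ∈ Finset.range (2 * N), (1 - q * q ^ j)) *
        invQFactorial q (N - k) * invQFactorial q (N + k) * t k)
      ((∏ j ∈ Finset.range N, (1 - y * q ^ j)) *
        ∏ j ∈ Finset.range N, (1 - q / y * q ^ j)) := by
  induction N with
  | zero =>
    convert hasSum_ite_eq (0 : ℤ) (1 : ℂ) using 2 with k
    · rcases lt_trichotomy k 0 with h | rfl | h
      · simp [invQFactorial, h, h.ne]
      · simp [invQFactorial, ht0]
      · simp [invQFactorial, h, h.ne']
    · simp
  | succ N ih =>
    have h1 := ih.mul_left (1 + q ^ (2 * N + 1))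
    have h2 := ((Equiv.subRight (1 : ℤ)).hasSum_iff.2 ih).mul_left (-(y * q ^ N))
    have h3 := ((Equiv.addRight (1 : ℤ)).hasSum_iff.2 ih).mul_left (-(q ^ (N + 1) / y))
    have hval (a b : ℂ) : a * (1 - y * q ^ N) * (b * (1 - q / y * q ^ N)) =
        (1 + q ^ (2 * N + 1)) * (a * b) + -(y * q ^ N) * (a * b) +
          -(q ^ (N + 1) / y) * (a * b) := by
      field_simp
      ring
    rw [Finset.prod_range_succ _ N, Finset.prod_range_succ _ N, hval]
    refine ((h1.add h2).add h3).congr_fun fun k => ?_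
    simp only [Function.comp, Equiv.subRight_apply, Equiv.coe_addRight]
    have e1 : t k = -y * (q ^ k / q) * t (k - 1) := by
      have := ht (k - 1)
      rwa [sub_add_cancel, zpow_sub_one₀ hq0, ← div_eq_mul_inv] at this
    have hk0 : q ^ k ≠ 0 := zpow_ne_zero _ hq0
    have e2 : t (k - 1) = -(q / (y * q ^ k)) * t k := by
      rw [e1]; field_simp
    have a1 := invQFactorial_sub_one hq (N + 1 - k)
    have a2 := invQFactorial_sub_one hq (N + 1 - k - 1)
    have c1 := invQFactorial_sub_one hq (N + 1 + k)
    have c2 := invQFactorial_sub_one hq (N + 1 + k - 1)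
    rw [show (N : ℤ) + 1 - k - 1 = N - k by ring] at a1 a2
    rw [show (N : ℤ) - k - 1 = N - (k + 1) by ring] at a2
    rw [show (N : ℤ) + 1 + k - 1 = N + k by ring] at c1 c2
    rw [show (N : ℤ) + k - 1 = N + (k - 1) by ring] at c2
    rw [show (N : ℤ) - (k - 1) = N + 1 - k by ring, show (N : ℤ) + (k + 1) = N + 1 + k by ring,
      a2, c2, a1, c1, e2, ht k]
    push_cast
    rw [show 2 * (N + 1) = 2 * N + 1 + 1 by ring, Finset.prod_range_succ,
      Finset.prod_range_succ]
    have z1 : q ^ ((N : ℤ) + 1 - k) = q * q ^ N / q ^ k := by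
      rw [zpow_sub₀ hq0, zpow_add_one₀ hq0, zpow_natCast, mul_comm]
    have z2 : q ^ ((N : ℤ) - k) = q ^ N / q ^ k := by
      rw [zpow_sub₀ hq0, zpow_natCast]
    have z3 : q ^ ((N : ℤ) + 1 + k) = q * q ^ N * q ^ k := by
      rw [zpow_add₀ hq0, zpow_add_one₀ hq0, zpow_natCast, mul_comm q]
    have z4 : q ^ ((N : ℤ) + k) = q ^ N * q ^ k := by
      rw [zpow_add₀ hq0, zpow_natCast]
    rw [z1, z2, z3, z4]
    generalize q ^ k = K at *
    simp only [pow_succ, pow_mul']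
    generalize q ^ N = M at *
    field_simp
    ring

/-- The Jacobi triple product identity. -/
lemma qtheta_eq_thetaSum_div {P : ℂ} (hP : P.re < 0) {C y q : ℂ} (hC : Complex.exp C = -y)
    (hPq : Complex.exp (2 * P) = q) : qtheta q y = thetaSum P C / qpinf q q := by
  have hq0 : q ≠ 0 := hPq ▸ Complex.exp_ne_zero _
  have hq : ‖q‖ < 1 := by
    rw [← hPq, Complex.norm_exp, Real.exp_lt_one_iff]
    simp
    linarith
  have hy : y ≠ 0 := neg_ne_zero.1 (hC ▸ Complex.exp_ne_zero _)
  have hQ := qpinf_ne_zero hq (mul_pow_self_ne_one hq)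
  have hsum := hasSum_finite_triple_product hq0 hq hy (t := thetaTerm P C) (by simp [thetaTerm])
    (fun k => by rw [thetaTerm_succ, hC, hPq])
  have hlim : Tendsto (fun N : ℕ => ∑' k : ℤ, (∏ j ∈ Finset.range (2 * N), (1 - q * q ^ j)) *
      invQFactorial q (N - k) * invQFactorial q (N + k) * thetaTerm P C k) atTop
      (𝓝 (∑' k : ℤ, qpinf q q * (qpinf q q)⁻¹ * (qpinf q q)⁻¹ * thetaTerm P C k)) := by
    obtain ⟨R, hR⟩ := exists_norm_invQFactorial_le hq
    obtain ⟨S, hS⟩ := (Metric.isBounded_range_of_tendsto _ (tendsto_qpinf hq q)).exists_norm_le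
    have hR0 : 0 ≤ R := (norm_nonneg _).trans (hR 0)
    have hS0 : 0 ≤ S := (norm_nonneg _).trans (hS _ ⟨0, rfl⟩)
    refine tendsto_tsum_of_dominated_convergence
      ((summable_norm_thetaTerm hP C).mul_left (S * R * R)) (fun k => ?_) (.of_forall fun N k => ?_)
    · have hd : Tendsto (fun N : ℕ => 2 * N) atTop atTop :=
        tendsto_id.const_mul_atTop' (by norm_num)
      refine ((((tendsto_qpinf hq q).comp hd).mul ?_).mul ?_).mul_const _
      · exact (tendsto_invQFactorial hq).comp
          (tendsto_atTop_add_const_right _ (-k) tendsto_natCast_atTop_atTop)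
      · exact (tendsto_invQFactorial hq).comp
          (tendsto_atTop_add_const_right _ k tendsto_natCast_atTop_atTop)
    · simp only [norm_mul]
      gcongr
      · exact hS _ ⟨2 * N, rfl⟩
      · exact hR _
      · exact hR _
  simp_rw [fun N => (hsum N).tsum_eq] at hlim
  have h := tendsto_nhds_unique ((tendsto_qpinf hq y).mul (tendsto_qpinf hq (q / y))) hlim
  rw [qtheta, h, tsum_mul_left, thetaSum]
  field_simp

end TripleProduct

section DoubleSeries

/-- The geometric sum `∑_{a ≤ j < b} z^j`, equal to `-∑_{b ≤ j < a} z^j` when `b < a`. -/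
def signedGeom (z : ℂ) (a b : ℤ) : ℂ := if z = 1 then b - a else (z ^ a - z ^ b) / (1 - z)

lemma signedGeom_self (z : ℂ) (a : ℤ) : signedGeom z a a = 0 := by
  simp [signedGeom]

lemma signedGeom_succ {z : ℂ} (hz : z ≠ 0) (a b : ℤ) :
    signedGeom z a (b + 1) = signedGeom z a b + z ^ b := by
  unfold signedGeom
  split_ifs with h
  · subst h
    push_cast
    simp
    ring
  · have : 1 - z ≠ 0 := sub_ne_zero.2 (Ne.symm h)
    rw [zpow_add_one₀ hz]
    field_simp
    ring

lemma hasSum_signedGeom {z : ℂ} (hz : z ≠ 0) (a b : ℤ) :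
    HasSum (fun j : ℤ => ((if a ≤ j then 1 else 0) - (if b ≤ j then 1 else 0)) * z ^ j)
      (signedGeom z a b) := by
  induction b using Int.inductionOn' (b := a) with
  | zero => simp [signedGeom_self, hasSum_zero]
  | succ b _ ih =>
    rw [signedGeom_succ hz]
    refine (ih.add (hasSum_ite_eq b (z ^ b))).congr_fun fun j => ?_
    rcases lt_trichotomy j b with h | rfl | h
    · simp [h.not_ge, h.ne, show ¬ b + 1 ≤ j by omega]
    · simp
      split_ifs
      ring
    · simp [h.le, h.ne', show b + 1 ≤ j by omega]
  | pred b _ ih =>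
    have h0 := signedGeom_succ hz a (b - 1)
    rw [sub_add_cancel] at h0
    rw [← sub_eq_iff_eq_add.2 h0]
    refine (ih.sub (hasSum_ite_eq (b - 1) (z ^ (b - 1)))).congr_fun fun j => ?_
    rcases lt_trichotomy j (b - 1) with h | rfl | h
    · simp [h.not_ge, h.ne, show ¬ b ≤ j by omega]
    · simp
      split_ifs <;> ring
    · simp [h.le, h.ne', show b ≤ j by omega]

/-- The terms of the triple series obtained by expanding the geometric sums. -/
def tripleTerm (P C X : ℂ) (n k m : ℤ) : ℂ :=
  ((if n + k ≤ m then 1 else 0) - (if 2 * n ≤ m then 1 else 0)) *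
    (thetaTerm P C k * Complex.exp (2 * n * C + m * X + 2 * n * m * P))

lemma norm_tripleTerm_le {P : ℂ} (hP : P.re < 0) (C X : ℂ) (n k m : ℤ) :
    ‖tripleTerm P C X n k m‖ ≤
      Real.exp (2 * C.re * n - (-P.re / 10) * n ^ 2) *
      Real.exp ((C.re - P.re) * k - (-P.re / 10) * k ^ 2) *
      Real.exp (X.re * m - (-P.re / 10) * m ^ 2) := by
  by_cases h : (n + k ≤ m ↔ 2 * n ≤ m)
  · have h0 : tripleTerm P C X n k m = 0 := by
      by_cases h' : 2 * n ≤ m <;> simp [tripleTerm, h, h']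
    rw [h0, norm_zero]
    positivity
  · have h1 : ‖tripleTerm P C X n k m‖ =
        ‖thetaTerm P C k * Complex.exp (2 * n * C + m * X + 2 * n * m * P)‖ := by
      rw [tripleTerm, norm_mul]
      by_cases h' : 2 * n ≤ m <;> by_cases h'' : n + k ≤ m
      · exact absurd (iff_of_true h'' h') h
      · simp [if_pos h', if_neg h'']
      · simp [if_neg h', if_pos h'']
      · exact absurd (iff_of_false h'' h') h
    have h2 : (m - n - k) * (m - 2 * n) ≤ 0 := by
      by_cases h' : 2 * n ≤ m
      · have : m < n + k := by by_contra hc; exact h (by simp_all)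
        nlinarith
      · have : n + k ≤ m := by by_contra hc; exact h (by simp_all)
        nlinarith
    have h3 : ((m : ℝ) - n - k) * (m - 2 * n) ≤ 0 := by exact_mod_cast h2
    rw [h1, norm_mul, norm_thetaTerm, Complex.norm_exp, ← Real.exp_add, ← Real.exp_add,
      ← Real.exp_add, Real.exp_le_exp]
    have h4 : ((n : ℝ) ^ 2 + k ^ 2 + m ^ 2) / 10 ≤ k ^ 2 + 2 * n * m := by
      nlinarith [sq_nonneg ((m : ℝ) - n / 2 - k / 2), sq_nonneg ((n : ℝ) + k / 2),
        sq_nonneg (n : ℝ), sq_nonneg (k : ℝ), sq_nonneg (m : ℝ)]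
    have h5 := mul_le_mul_of_nonneg_left h4 (neg_pos.2 hP).le
    have h6 : (2 * n * C + m * X + 2 * n * m * P).re =
        2 * n * C.re + m * X.re + 2 * n * m * P.re := by
      simp
    rw [h6]
    linarith

lemma summable_tripleTerm {P : ℂ} (hP : P.re < 0) (C X : ℂ) :
    Summable fun p : (ℤ × ℤ) × ℤ => tripleTerm P C X p.1.1 p.1.2 p.2 := by
  have hc : 0 < -P.re / 10 := by linarith
  refine Summable.of_norm_bounded ?_ fun p => norm_tripleTerm_le hP C X p.1.1 p.1.2 p.2
  have h1 := summable_exp_linear_sub_sq (2 * C.re) hc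
  have h2 := summable_exp_linear_sub_sq (C.re - P.re) hc
  have h3 := summable_exp_linear_sub_sq X.re hc
  have h12 := h1.mul_of_nonneg h2 (fun _ => (Real.exp_pos _).le) fun _ => (Real.exp_pos _).le
  exact h12.mul_of_nonneg h3
    (fun _ => (mul_pos (Real.exp_pos _) (Real.exp_pos _)).le) fun _ => (Real.exp_pos _).le

lemma hasSum_tripleTerm_left (P C X : ℂ) (n k : ℤ) :
    HasSum (fun m => tripleTerm P C X n k m)
      (thetaTerm P C k * Complex.exp (2 * n * C) *
        signedGeom (Complex.exp (X + 2 * n * P)) (n + k) (2 * n)) := by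
  refine ((hasSum_signedGeom (Complex.exp_ne_zero (X + 2 * n * P)) (n + k) (2 * n)).mul_left
    (thetaTerm P C k * Complex.exp (2 * n * C))).congr_fun fun m => ?_
  rw [tripleTerm, ← Complex.exp_int_mul,
    show 2 * n * C + m * X + 2 * n * m * P = 2 * n * C + m * (X + 2 * n * P) by ring,
    Complex.exp_add]
  ring

lemma hasSum_tripleTerm_right (P C X : ℂ) (m k : ℤ) :
    HasSum (fun n => tripleTerm P C X n k m)
      (Complex.exp (m * X) * (thetaTerm P C k *
        signedGeom (Complex.exp (2 * C + 2 * m * P)) (m / 2 + 1) (m - k + 1))) := by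
  rw [← mul_assoc]
  refine ((hasSum_signedGeom (Complex.exp_ne_zero (2 * C + 2 * m * P)) (m / 2 + 1)
    (m - k + 1)).mul_left (Complex.exp (m * X) * thetaTerm P C k)).congr_fun fun n => ?_
  rw [tripleTerm, ← Complex.exp_int_mul,
    show 2 * n * C + m * X + 2 * n * m * P = m * X + n * (2 * C + 2 * m * P) by ring,
    Complex.exp_add]
  have h1 : n + k ≤ m ↔ ¬ m - k + 1 ≤ n := by omega
  have h2 : 2 * n ≤ m ↔ ¬ m / 2 + 1 ≤ n := by omega
  simp only [h1, h2]
  split_ifs <;> simp_all <;> ring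

lemma hasSum_tripleTerm_fiber {P : ℂ} (hP : P.re < 0) (C X : ℂ) (n : ℤ)
    (hX : Complex.exp (X + 2 * n * P) ≠ 1) :
    HasSum (fun k => thetaTerm P C k * Complex.exp (2 * n * C) *
        signedGeom (Complex.exp (X + 2 * n * P)) (n + k) (2 * n))
      (thetaSum P (X + C) * (Complex.exp (n * C + n * (n + 1) * P) /
          (1 - Complex.exp (X + 2 * n * P))) -
        thetaSum P C * (Complex.exp (2 * n * (X + C) + 4 * n ^ 2 * P) /
          (1 - Complex.exp (X + 2 * n * P)))) := by
  have h1 := ((Equiv.addRight n).hasSum_iff.2 (hasSum_thetaTerm hP (X + C))).mul_right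
    (Complex.exp (n * C + n * (n + 1) * P) / (1 - Complex.exp (X + 2 * n * P)))
  have h2 := (hasSum_thetaTerm hP C).mul_right
    (Complex.exp (2 * n * (X + C) + 4 * n ^ 2 * P) / (1 - Complex.exp (X + 2 * n * P)))
  refine (h1.sub h2).congr_fun fun k => ?_
  rw [signedGeom, if_neg hX, ← Complex.exp_int_mul, ← Complex.exp_int_mul]
  simp only [Function.comp, Equiv.coe_addRight, thetaTerm, ← mul_div_assoc, mul_sub,
    ← Complex.exp_add, ← sub_div]
  congr 3 <;> · push_cast; ring

lemma thetaTerm_reflect (P C : ℂ) (m k : ℤ) :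
    thetaTerm P C (m + 1 - k) =
      Complex.exp ((m + 1 - 2 * k) * C + (m * (m + 1) - 2 * m * k) * P) * thetaTerm P C k := by
  rw [thetaTerm, thetaTerm, ← Complex.exp_add]
  congr 1
  push_cast
  ring

lemma hasSum_thetaTerm_mul_signedGeom_odd (P C : ℂ) (N : ℤ)
    (hs : Summable fun k => thetaTerm P C k *
      signedGeom (Complex.exp (2 * C + 2 * (2 * N + 1 : ℤ) * P)) (N + 1) (2 * N + 1 - k + 1)) :
    HasSum (fun k => thetaTerm P C k *
      signedGeom (Complex.exp (2 * C + 2 * (2 * N + 1 : ℤ) * P)) (N + 1) (2 * N + 1 - k + 1))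
      0 := by
  obtain ⟨U, hU⟩ := hs
  have h := (Equiv.subLeft (2 * N + 1 + 1)).hasSum_iff.2 hU
  have h' : HasSum _ (-U) := hU.neg
  have hU0 : U = -U := by
    refine h.unique (h'.congr_fun fun k => ?_)
    simp only [Function.comp, Equiv.subLeft_apply, thetaTerm_reflect]
    set z := Complex.exp (2 * C + 2 * (2 * N + 1 : ℤ) * P) with hz
    have hz0 : z ≠ 0 := Complex.exp_ne_zero _
    have hm : Complex.exp (((2 * N + 1 : ℤ) + 1 - 2 * k) * C + ((2 * N + 1 : ℤ) *
        ((2 * N + 1 : ℤ) + 1) - 2 * (2 * N + 1 : ℤ) * k) * P) = z ^ (N + 1 - k) := by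
      rw [hz, ← Complex.exp_int_mul]
      congr 1
      push_cast
      ring
    rw [hm]
    unfold signedGeom
    split_ifs with h1
    · rw [h1]
      push_cast
      simp
      ring
    · rw [show 2 * N + 1 - (2 * N + 1 + 1 - k) + 1 = k by ring, zpow_sub₀ hz0,
        show 2 * N + 1 - k + 1 = (N + 1) + (N + 1) - k by ring, zpow_sub₀ hz0, zpow_add₀ hz0 (N + 1),
        zpow_add_one₀ hz0]
      have : 1 - z ≠ 0 := sub_ne_zero.2 (Ne.symm h1)
      have : z ^ k ≠ 0 := zpow_ne_zero _ hz0
      field_simp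
      ring
  have hU00 : U = 0 := by linear_combination hU0 / 2
  rwa [hU00] at hU

lemma signedGeom_sq_sub {v : ℂ} (hv0 : v ≠ 0) (hv : v ≠ -1) (N k : ℤ) :
    signedGeom (v ^ 2) (N + 1) (2 * N - k + 1) + v ^ (2 * N + 1 - 2 * k) *
      signedGeom (v ^ 2) (N + 1) k = -(v ^ (2 * N + 1) + v ^ (4 * N + 2 - 2 * k)) / (1 + v) := by
  have h1 : 1 + v ≠ 0 := fun h => hv (by linear_combination h)
  unfold signedGeom
  split_ifs with h2
  · have hv1 : v = 1 := mul_left_cancel₀ h1 (by linear_combination h2)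
    subst hv1
    push_cast
    simp
    ring
  · have h3 : 1 - v ^ 2 ≠ 0 := sub_ne_zero.2 (Ne.symm h2)
    have hsq (j : ℤ) : (v ^ 2) ^ j = v ^ j * v ^ j := by
      rw [← mul_zpow, sq]
    have e1 : v ^ (2 * N + 1) = v ^ N * v ^ N * v := by
      rw [zpow_add_one₀ hv0, two_mul, zpow_add₀ hv0]
    have e2 : v ^ (2 * k) = v ^ k * v ^ k := by rw [two_mul, zpow_add₀ hv0]
    rw [hsq, hsq, hsq, show 4 * N + 2 - 2 * k = (2 * N + 1) + (2 * N + 1) - 2 * k by ring,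
      zpow_sub₀ hv0, zpow_sub₀ hv0, zpow_add₀ hv0 (2 * N + 1), e1, e2,
      show 2 * N - k + 1 = (2 * N + 1) - k by ring, zpow_sub₀ hv0, e1, zpow_add_one₀ hv0]
    have : v ^ k ≠ 0 := zpow_ne_zero _ hv0
    have h4 : 1 - v ^ 2 = (1 - v) * (1 + v) := by ring
    rw [h4] at h3 ⊢
    have h5 := left_ne_zero_of_mul h3
    field_simp
    ring

lemma hasSum_thetaTerm_mul_signedGeom_even {P : ℂ} (hP : P.re < 0) (C : ℂ) (N : ℤ)
    (hC : Complex.exp (C + 2 * N * P) ≠ -1)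
    (hs : Summable fun k => thetaTerm P C k *
      signedGeom (Complex.exp (2 * C + 2 * (2 * N : ℤ) * P)) (N + 1) (2 * N - k + 1)) :
    HasSum (fun k => thetaTerm P C k *
      signedGeom (Complex.exp (2 * C + 2 * (2 * N : ℤ) * P)) (N + 1) (2 * N - k + 1))
      (-(thetaSum P C * (Complex.exp (C + 2 * N * P) ^ (2 * N + 1) /
        (1 + Complex.exp (C + 2 * N * P))))) := by
  obtain ⟨U, hU⟩ := hs
  have hT := hasSum_thetaTerm hP C
  set v := Complex.exp (C + 2 * N * P) with hv
  have hv0 : v ≠ 0 := Complex.exp_ne_zero _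
  have hz : Complex.exp (2 * C + 2 * (2 * N : ℤ) * P) = v ^ 2 := by
    rw [hv, ← Complex.exp_nat_mul]
    congr 1
    push_cast
    ring
  have hr (k : ℤ) : thetaTerm P C (2 * N + 1 - k) =
      v ^ (2 * N + 1 - 2 * k) * thetaTerm P C k := by
    rw [thetaTerm_reflect, hv, ← Complex.exp_int_mul]
    congr 2
    push_cast
    ring
  rw [hz] at hU ⊢
  have h1 := hU.add ((Equiv.subLeft (2 * N + 1)).hasSum_iff.2 hU)
  have h2 := (hT.mul_right (-(v ^ (2 * N + 1) / (1 + v)))).add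
    (((Equiv.subLeft (2 * N + 1)).hasSum_iff.2 hT).mul_right (-(v ^ (2 * N + 1) / (1 + v))))
  have h3 := h1.unique (h2.congr_fun fun k => ?_)
  · have h4 : U = -(thetaSum P C * (v ^ (2 * N + 1) / (1 + v))) := by linear_combination h3 / 2
    rwa [h4] at hU
  · simp only [Function.comp, Equiv.subLeft_apply, hr]
    have h5 := signedGeom_sq_sub hv0 hC N k
    rw [show 2 * N - (2 * N + 1 - k) + 1 = k by ring]
    rw [show 4 * N + 2 - 2 * k = (2 * N + 1) + (2 * N + 1 - 2 * k) by ring,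
      zpow_add₀ hv0 (2 * N + 1)] at h5
    linear_combination thetaTerm P C k * h5

lemma exists_norm_inv_one_sub_exp_le {P : ℂ} (hP : P.re < 0) (X : ℂ) :
    ∃ K, 0 ≤ K ∧ ∀ n : ℤ, ‖(1 - Complex.exp (X + 2 * n * P))⁻¹‖ ≤ K := by
  have hlim (Y : ℂ) : Tendsto (fun j : ℕ => Complex.exp (Y + 2 * j * P)) atTop (𝓝 0) := by
    have h : ‖Complex.exp (2 * P)‖ < 1 := by
      rw [Complex.norm_exp, Real.exp_lt_one_iff]
      simp
      linarith
    have h1 := (tendsto_pow_atTop_nhds_zero_of_norm_lt_one h).const_mul (Complex.exp Y)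
    rw [mul_zero] at h1
    refine h1.congr fun j => ?_
    rw [← Complex.exp_nat_mul, ← Complex.exp_add]
    congr 1
    ring
  have h1 : Tendsto (fun j : ℕ => (1 - Complex.exp (X + 2 * j * P))⁻¹) atTop (𝓝 (1 - 0)⁻¹) :=
    ((hlim X).const_sub 1).inv₀ (by simp)
  have h2 : Tendsto (fun j : ℕ => Complex.exp (-X + 2 * j * P) /
      (Complex.exp (-X + 2 * j * P) - 1)) atTop (𝓝 (0 / (0 - 1))) :=
    (hlim (-X)).div ((hlim (-X)).sub_const 1) (by simp)
  obtain ⟨K1, hK1⟩ := (Metric.isBounded_range_of_tendsto _ h1).exists_norm_le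
  obtain ⟨K2, hK2⟩ := (Metric.isBounded_range_of_tendsto _ h2).exists_norm_le
  refine ⟨max K1 K2, ((norm_nonneg _).trans (hK1 _ ⟨0, rfl⟩)).trans (le_max_left _ _),
    fun n => ?_⟩
  obtain ⟨j, rfl | rfl⟩ := n.eq_nat_or_neg
  · exact (hK1 _ ⟨j, by simp⟩).trans (le_max_left _ _)
  · refine le_trans (hK2 _ ⟨j, ?_⟩) (le_max_right _ _)
    have h : X + 2 * ((-j : ℤ) : ℂ) * P = -(-X + 2 * j * P) := by
      push_cast
      ring
    have h0 := Complex.exp_ne_zero (-X + 2 * j * P)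
    simp only [h, Complex.exp_neg (-X + 2 * j * P)]
    rw [← inv_div]
    congr 1
    field_simp

lemma summable_norm_exp_div {P : ℂ} (hP : P.re < 0) (X : ℂ) (A B : ℂ) {r : ℝ} (hr : 0 < r) :
    Summable fun n : ℤ =>
      ‖Complex.exp (n * A + B + r * n ^ 2 * P) / (1 - Complex.exp (X + 2 * n * P))‖ := by
  obtain ⟨K, hK0, hK⟩ := exists_norm_inv_one_sub_exp_le hP X
  have hc : 0 < -P.re * r := mul_pos (neg_pos.2 hP) hr
  refine Summable.of_nonneg_of_le (fun _ => norm_nonneg _) (fun n => ?_)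
    ((summable_exp_linear_sub_sq A.re hc).mul_left (Real.exp B.re * K))
  rw [div_eq_mul_inv, norm_mul, Complex.norm_exp, mul_right_comm (Real.exp B.re),
    ← Real.exp_add]
  refine mul_le_mul (Real.exp_le_exp.2 (le_of_eq ?_)) (hK n) (norm_nonneg _) (Real.exp_pos _).le
  simp [sq]
  ring

/-- The Appell–Lerch type identity behind the symmetric expansion of `μ`. -/
lemma thetaSum_mul_tsum_eq {P : ℂ} (hP : P.re < 0) (C X : ℂ)
    (hX : ∀ n : ℤ, Complex.exp (X + 2 * n * P) ≠ 1)
    (hC : ∀ n : ℤ, Complex.exp (C + 2 * n * P) ≠ -1) :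
    thetaSum P (X + C) * (∑' n : ℤ, Complex.exp (n * C + n * (n + 1) * P) /
        (1 - Complex.exp (X + 2 * n * P))) =
      thetaSum P C * ((∑' n : ℤ, Complex.exp (2 * n * (X + C) + 4 * n ^ 2 * P) /
        (1 - Complex.exp (X + 2 * n * P))) -
        ∑' n : ℤ, Complex.exp (2 * n * X) * (Complex.exp (C + 2 * n * P) ^ (2 * n + 1) /
          (1 + Complex.exp (C + 2 * n * P)))) := by
  have hα : Summable fun n : ℤ => Complex.exp (n * C + n * (n + 1) * P) /
      (1 - Complex.exp (X + 2 * n * P)) := by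
    refine (summable_norm_exp_div hP X (C + P) 0 one_pos).of_norm.congr fun n => ?_
    congr 2
    push_cast
    ring
  have hβ : Summable fun n : ℤ => Complex.exp (2 * n * (X + C) + 4 * n ^ 2 * P) /
      (1 - Complex.exp (X + 2 * n * P)) := by
    refine (summable_norm_exp_div hP X (2 * (X + C)) 0 four_pos).of_norm.congr fun n => ?_
    congr 2
    push_cast
    ring
  obtain ⟨S, hS⟩ := summable_tripleTerm hP C X
  have hS1 : HasSum (fun n : ℤ => _) S :=
    (hS.prod_fiberwise fun p => hasSum_tripleTerm_left P C X p.1 p.2).prod_fiberwise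
      fun n => hasSum_tripleTerm_fiber hP C X n (hX n)
  have e1 := hS1.unique ((hα.hasSum.mul_left _).sub (hβ.hasSum.mul_left _))
  let σ : (ℤ × ℤ) × ℤ ≃ (ℤ × ℤ) × ℤ :=
    ⟨fun p => ((p.2, p.1.2), p.1.1), fun p => ((p.2, p.1.2), p.1.1), fun _ => rfl, fun _ => rfl⟩
  have hS2 := (σ.hasSum_iff.2 hS).prod_fiberwise
    fun p => hasSum_tripleTerm_right P C X p.1 p.2
  have hfib (m : ℤ) : Summable fun k : ℤ => thetaTerm P C k *
      signedGeom (Complex.exp (2 * C + 2 * m * P)) (m / 2 + 1) (m - k + 1) :=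
    (summable_mul_left_iff (Complex.exp_ne_zero (m * X))).1 (hS2.summable.prod_factor m)
  have hS3 := hS2.prod_fiberwise fun m => ((hfib m).hasSum.mul_left (Complex.exp (m * X)))
  have hodd (m : ℤ) (hm : m ∉ Set.range fun N : ℤ => 2 * N) : Complex.exp (m * X) *
      ∑' k : ℤ, thetaTerm P C k *
        signedGeom (Complex.exp (2 * C + 2 * m * P)) (m / 2 + 1) (m - k + 1) = 0 := by
    have hm' : 2 * (m / 2) ≠ m := fun h => hm ⟨m / 2, h⟩
    obtain ⟨N, rfl⟩ : ∃ N, m = 2 * N + 1 := ⟨m / 2, by omega⟩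
    have h := hfib (2 * N + 1)
    rw [show (2 * N + 1) / 2 + 1 = N + 1 by omega] at h ⊢
    rw [(hasSum_thetaTerm_mul_signedGeom_odd P C N h).tsum_eq, mul_zero]
  have hinj : Function.Injective fun N : ℤ => 2 * N := fun a b h => by simpa using h
  have hS4 := (hinj.hasSum_iff hodd).2 hS3
  have e2 : S = ∑' n : ℤ, -(thetaSum P C * (Complex.exp (2 * n * X) *
      (Complex.exp (C + 2 * n * P) ^ (2 * n + 1) / (1 + Complex.exp (C + 2 * n * P))))) := by
    rw [← hS4.tsum_eq]
    refine tsum_congr fun N => ?_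
    have h := hfib (2 * N)
    simp only [Function.comp]
    rw [show 2 * N / 2 + 1 = N + 1 by omega] at h ⊢
    rw [(hasSum_thetaTerm_mul_signedGeom_even hP C N (hC N) h).tsum_eq]
    push_cast
    ring
  rw [tsum_neg, tsum_mul_left] at e2
  linear_combination e2 - e1

end DoubleSeries

lemma e_ne_zpow {τ v : ℂ} (hv : ∀ m n : ℤ, v ≠ (m : ℂ) + (n : ℂ) * τ) (n : ℤ) :
    e v ≠ e τ ^ n := by
  intro h
  rw [e, e, ← Complex.exp_int_mul, Complex.exp_eq_exp_iff_exists_int] at h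
  obtain ⟨m, hm⟩ := h
  refine hv m n (mul_left_cancel₀ Complex.two_pi_I_ne_zero ?_)
  linear_combination hm

lemma qtheta_ne_zero {q y : ℂ} (hq0 : q ≠ 0) (hq : ‖q‖ < 1) (hy0 : y ≠ 0)
    (hy : ∀ m : ℤ, y ≠ q ^ m) : qtheta q y ≠ 0 := by
  refine mul_ne_zero (qpinf_ne_zero hq fun j h => hy (-j) ?_)
    (qpinf_ne_zero hq fun j h => hy (j + 1) ?_)
  · rw [zpow_neg, zpow_natCast]
    exact eq_inv_of_mul_eq_one_left h
  · rw [zpow_add_one₀ hq0, zpow_natCast]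
    field_simp at h
    linear_combination -h

lemma appell_prefactor_identity {a b c Q s t A B : ℂ} (ha : a ≠ 0) (hb : b ≠ 0) (hQ : Q ≠ 0)
    (ht : t ≠ 0) (hs : s ≠ 0) (h : s * A = t * B) :
    c * b / (-Complex.I * a * b * Q * t) * A = Complex.I * (1 / a) * c / (Q * s) * B := by
  have hI := Complex.I_ne_zero
  field_simp
  rw [Complex.I_sq]
  linear_combination -c * h

theorem stmt4 (τ u v : ℂ) (hτ : 0 < τ.im)
    (hu : ∀ m n : ℤ, u ≠ (m : ℂ) + (n : ℂ) * τ)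
    (hv : ∀ m n : ℤ, v ≠ (m : ℂ) + (n : ℂ) * τ)
    (q x y : ℂ) (hq : q = e τ) (hx : x = e u) (hy : y = e v)
    (hxy : ∀ m : ℤ, x * y ≠ q ^ m) :
    Summable (fun n : ℤ =>
      ‖(1 - x * y * q ^ (2 * n)) / ((1 - x * q ^ n) * (1 - y * q ^ n)) *
        (x ^ (2 * n) * y ^ (2 * n) * q ^ (2 * n ^ 2))‖) ∧
    zMu τ u v =
      Complex.I * e (-τ / 8) * e ((u + v) / 2) / (qpinf q q * qtheta q (x * y)) *
        ∑' n : ℤ, (1 - x * y * q ^ (2 * n)) / ((1 - x * q ^ n) * (1 - y * q ^ n)) *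
          (x ^ (2 * n) * y ^ (2 * n) * q ^ (2 * n ^ 2)) := by
  set P : ℂ := Real.pi * Complex.I * τ with hP
  set X : ℂ := 2 * Real.pi * Complex.I * u with hX
  set Y : ℂ := 2 * Real.pi * Complex.I * v with hY
  set C : ℂ := Y + Real.pi * Complex.I with hC
  have hPre : P.re < 0 := by
    simpa [hP] using mul_pos Real.pi_pos hτ
  have hqP : q = Complex.exp (2 * P) := by
    rw [hq, e, hP]
    congr 1
    ring
  have hxX : x = Complex.exp X := by rw [hx, e]
  have hyY : y = Complex.exp Y := by rw [hy, e]
  have hyC : Complex.exp C = -y := by rw [hC, Complex.exp_add, Complex.exp_pi_mul_I, hyY]; ring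
  have hq0 : q ≠ 0 := hqP ▸ Complex.exp_ne_zero _
  have hx0 : x ≠ 0 := hxX ▸ Complex.exp_ne_zero _
  have hy0 : y ≠ 0 := hyY ▸ Complex.exp_ne_zero _
  have hq1 : ‖q‖ < 1 := by
    rw [hqP, Complex.norm_exp, Real.exp_lt_one_iff]
    simp
    linarith
  have hxq (n : ℤ) : Complex.exp (X + 2 * n * P) = x * q ^ n := by
    rw [hxX, hqP, ← Complex.exp_int_mul, ← Complex.exp_add]
    congr 1
    ring
  have hyq (n : ℤ) : Complex.exp (Y + 2 * n * P) = y * q ^ n := by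
    rw [hyY, hqP, ← Complex.exp_int_mul, ← Complex.exp_add]
    congr 1
    ring
  have hcq (n : ℤ) : Complex.exp (C + 2 * n * P) = -(y * q ^ n) := by
    rw [Complex.exp_add, hyC, ← hyq, Complex.exp_add, hyY]
    ring
  have hxne (m : ℤ) : x ≠ q ^ m := by rw [hx, hq]; exact e_ne_zpow hu m
  have hyne (m : ℤ) : y ≠ q ^ m := by rw [hy, hq]; exact e_ne_zpow hv m
  have hxq1 (n : ℤ) : x * q ^ n ≠ 1 := fun h => hxne (-n) <| by
    rw [zpow_neg]
    exact eq_inv_of_mul_eq_one_left h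
  have hyq1 (n : ℤ) : y * q ^ n ≠ 1 := fun h => hyne (-n) <| by
    rw [zpow_neg]
    exact eq_inv_of_mul_eq_one_left h
  have hQ : qpinf q q ≠ 0 := qpinf_ne_zero hq1 (mul_pow_self_ne_one hq1)
  have hθy : qtheta q y ≠ 0 := qtheta_ne_zero hq0 hq1 hy0 hyne
  have hθxy : qtheta q (x * y) ≠ 0 := qtheta_ne_zero hq0 hq1 (mul_ne_zero hx0 hy0) hxy
  have hTy : thetaSum P C = qpinf q q * qtheta q y := by
    rw [qtheta_eq_thetaSum_div hPre hyC hqP.symm]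
    field_simp
  have hTxy : thetaSum P (X + C) = qpinf q q * qtheta q (x * y) := by
    rw [qtheta_eq_thetaSum_div hPre (C := X + C)
      (by rw [Complex.exp_add, hyC, hxX]; ring) hqP.symm]
    field_simp
  have key := thetaSum_mul_tsum_eq hPre C X (fun n => hxq n ▸ hxq1 n)
    (fun n => by rw [hcq]; exact fun h => hyq1 n (neg_injective h))
  have hβ : Summable fun n : ℤ => ‖Complex.exp (2 * n * (X + C) + 4 * n ^ 2 * P) /
      (1 - Complex.exp (X + 2 * n * P))‖ := by
    refine (summable_norm_exp_div hPre X (2 * (X + C)) 0 four_pos).congr fun n => ?_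
    congr 3
    push_cast
    ring
  have hβ' : Summable fun n : ℤ => ‖Complex.exp (2 * n * X) *
      (Complex.exp (C + 2 * n * P) ^ (2 * n + 1) / (1 + Complex.exp (C + 2 * n * P)))‖ := by
    refine (summable_norm_exp_div hPre Y (2 * X + 2 * C + 2 * P) C four_pos).congr fun n => ?_
    rw [hyq, hcq, ← sub_eq_add_neg, ← hcq, ← Complex.exp_int_mul, ← mul_div_assoc,
      ← Complex.exp_add]
    congr 3
    push_cast
    ring
  have hsplit (n : ℤ) : (1 - x * y * q ^ (2 * n)) / ((1 - x * q ^ n) * (1 - y * q ^ n)) *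
        (x ^ (2 * n) * y ^ (2 * n) * q ^ (2 * n ^ 2)) =
      Complex.exp (2 * n * (X + C) + 4 * n ^ 2 * P) / (1 - Complex.exp (X + 2 * n * P)) -
      Complex.exp (2 * n * X) * (Complex.exp (C + 2 * n * P) ^ (2 * n + 1) /
        (1 + Complex.exp (C + 2 * n * P))) := by
    have h1 : 1 - x * q ^ n ≠ 0 := sub_ne_zero.2 (hxq1 n).symm
    have h2 : 1 - y * q ^ n ≠ 0 := sub_ne_zero.2 (hyq1 n).symm
    have hodd : (-(y * q ^ n)) ^ (2 * n + 1) = -(y ^ (2 * n) * q ^ (2 * n ^ 2) * (y * q ^ n)) := by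
      rw [Odd.neg_zpow ⟨n, rfl⟩, zpow_add_one₀ (mul_ne_zero hy0 (zpow_ne_zero _ hq0)), mul_zpow,
        ← zpow_mul, show n * (2 * n) = 2 * n ^ 2 by ring]
    have hA : Complex.exp (2 * n * (X + C) + 4 * n ^ 2 * P) =
        x ^ (2 * n) * y ^ (2 * n) * q ^ (2 * n ^ 2) := by
      rw [← Even.neg_zpow (even_two_mul n) y, ← hyC, hxX, hqP, ← Complex.exp_int_mul,
        ← Complex.exp_int_mul, ← Complex.exp_int_mul, ← Complex.exp_add, ← Complex.exp_add]
      congr 1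
      push_cast
      ring
    have hB : Complex.exp (2 * n * X) = x ^ (2 * n) := by
      rw [hxX, ← Complex.exp_int_mul]
      congr 1
      push_cast
      ring
    rw [hA, hB, hxq, hcq, hodd, ← sub_eq_add_neg, show q ^ (2 * n) = q ^ n * q ^ n by
      rw [two_mul, zpow_add₀ hq0]]
    field_simp
    ring
  refine ⟨Summable.of_nonneg_of_le (fun _ => norm_nonneg _) (fun n => ?_) (hβ.add hβ'), ?_⟩
  · rw [hsplit]
    exact norm_sub_le _ _
  have hα (n : ℤ) : (-1 : ℂ) ^ n * e (n * v) * e τ ^ (n * (n + 1) / 2) / (1 - e u * e τ ^ n) =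
      Complex.exp (n * C + n * (n + 1) * P) / (1 - Complex.exp (X + 2 * n * P)) := by
    rw [hxq, hx, hq]
    congr 1
    have h2 : (2 : ℂ) * ((n * (n + 1) / 2 : ℤ) : ℂ) = n * (n + 1) := by
      exact_mod_cast Int.two_mul_ediv_two_of_even (Int.even_mul_succ_self n)
    rw [← Complex.exp_pi_mul_I, ← hq, hqP, e, ← Complex.exp_int_mul, ← Complex.exp_int_mul,
      ← Complex.exp_add, ← Complex.exp_add]
    congr 1
    linear_combination P * h2
  rw [← hβ.of_norm.tsum_sub hβ'.of_norm] at key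
  simp_rw [zMu, hα, hsplit, theta11, ← hq, ← hy]
  rw [hTy, hTxy] at key
  have hτ8 : e (-τ / 8) * e (τ / 8) = 1 := by
    rw [e, e, ← Complex.exp_add, ← Complex.exp_zero]
    congr 1
    ring
  have huv : e ((u + v) / 2) * e (-v / 2) = e (u / 2) := by
    rw [e, e, e, ← Complex.exp_add]
    congr 1
    ring
  have h8 : e (τ / 8) ≠ 0 := Complex.exp_ne_zero _
  have hv2 : e (-v / 2) ≠ 0 := Complex.exp_ne_zero _
  rw [← huv, eq_div_of_mul_eq h8 hτ8]
  exact appell_prefactor_identity h8 hv2 hQ hθy hθxy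
    (mul_left_cancel₀ hQ ((mul_assoc _ _ _).symm.trans (key.trans (mul_assoc _ _ _))))
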